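/- With the clock construction of the trihex from a closed 4-bar triple, the central hexagon x₁x₂x₃x₄x₅x₆ has opposite sides equal in length and antiparallel: x₅ − x₄ = −(x₂ − x₁), x₆ − x₅ = −(x₃ − x₂), and x₁ − x₆ = −(x₄ − x₃). (This uses the identity I + R + R² = 0 for the 120° rotation R.) -/

import Mathlib

noncomputable section

/-- The Euclidean plane ℝ². -/
abbrev Plane := EuclideanSpace ℝ (Fin 2)

/-- The rotation of the plane about the origin by 120°. -/
noncomputable def rot120 (v : Plane) : Plane :=
  (WithLp.equiv 2 (Fin 2 → ℝ)).symm
    ![-(v 0) / 2 - Real.sqrt 3 / 2 * v 1, Real.sqrt 3 / 2 * v 0 - v 1 / 2]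

theorem rot120_add (v w : Plane) : rot120 (v + w) = rot120 v + rot120 w := by
  ext i
  fin_cases i <;> simp [rot120] <;> ring

theorem rot120_sub (v w : Plane) : rot120 (v - w) = rot120 v - rot120 w := by
  ext i
  fin_cases i <;> simp [rot120] <;> ring

/-- The identity `I + R + R² = 0` for the rotation `R` by 120°. -/
theorem add_rot120_add_rot120_rot120 (v : Plane) :
    v + rot120 v + rot120 (rot120 v) = 0 := by
  have h : Real.sqrt 3 ^ 2 = 3 := Real.sq_sqrt (by norm_num)
  ext i
  fin_cases i
  · simp [rot120]
    linear_combination -(v 0) / 4 * h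
  · simp [rot120]
    linear_combination -(v 1) / 4 * h

/-- In the clock construction of the trihex from a closed 4-bar triple, the central
hexagon `x₁x₂x₃x₄x₅x₆` has opposite sides equal in length and antiparallel:
`x₅ − x₄ = −(x₂ − x₁)`, `x₆ − x₅ = −(x₃ − x₂)`, and `x₁ − x₆ = −(x₄ − x₃)`.
(This uses the identity `I + R + R² = 0` for the 120° rotation `R`.) -/
theorem clock_hexagon_opposite_sides_antiparallel
    (P A B C : Plane) (hP : P ≠ 0)
    (hA : ‖A‖ = 1) (hB : ‖B‖ = 1) (hC : ‖C‖ = 1)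
    (hclose : A + B + C = rot120 P - P) :
    ∀ x₁ x₂ x₃ x₄ x₅ x₆ : Plane,
      x₁ = P + A → x₂ = P + A + B →
      x₃ = rot120 P + rot120 C → x₄ = rot120 P + rot120 C + rot120 A →
      x₅ = rot120 (rot120 P) + rot120 (rot120 B) →
      x₆ = rot120 (rot120 P) + rot120 (rot120 B) + rot120 (rot120 C) →
      x₅ - x₄ = -(x₂ - x₁) ∧ x₆ - x₅ = -(x₃ - x₂) ∧ x₁ - x₆ = -(x₄ - x₃) := by
  rintro _ _ _ _ _ _ rfl rfl rfl rfl rfl rfl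
  have hclose₁ := congrArg rot120 hclose
  simp only [rot120_add, rot120_sub] at hclose₁
  have hB₀ := add_rot120_add_rot120_rot120 B
  have hC₀ := add_rot120_add_rot120_rot120 C
  refine ⟨?_, ?_, ?_⟩
  · linear_combination (norm := module) hB₀ - hclose₁
  · linear_combination (norm := module) hC₀ - hclose
  · linear_combination (norm := module) hclose + hclose₁ - hB₀ - hC₀
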